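/- Let n, k ≥ 1, let K_{t} be k×k real symmetric positive semidefinite matrices for t = 1, …, n whose diagonal entries are all at most K̄ for some K̄ ≥ 0, let γ_{t} ∈ ℝ^k be the vector of square roots of the diagonal entries of K_{t}, and let ψ ≥ 0. Then for any x_1, …, x_n ∈ {0,1}^k with 1ᵀx_t ≤ 1 for every t, one has 0 ≤ ψ·√(Σ_{t=1}^n x_tᵀ K_{t} x_t) − (ψ/√n)·Σ_{t=1}^n γ_{t}ᵀ x_t ≤ ψ·√(K̄)·√n. -/

import Mathlib

open Matrix BigOperators

theorem eq_zero_or_eq_single_of_sum_le_one {ι : Type*} [Fintype ι] [DecidableEq ι] {x : ι → ℝ}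
    (h01 : ∀ i, x i = 0 ∨ x i = 1) (h1 : ∑ i, x i ≤ 1) :
    x = 0 ∨ ∃ i, x = Pi.single i 1 := by
  have hnn : ∀ i, 0 ≤ x i := fun i => by rcases h01 i with h | h <;> simp [h]
  by_cases h : ∃ i, x i = 1
  · obtain ⟨i, hi⟩ := h
    refine Or.inr ⟨i, funext fun j => ?_⟩
    by_cases hj : j = i
    · subst hj
      simp [hi]
    · rw [Pi.single_eq_of_ne hj]
      have hsum := Finset.add_sum_erase Finset.univ x (Finset.mem_univ i)
      have hle := Finset.single_le_sum (fun m _ => hnn m)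
        (Finset.mem_erase.mpr ⟨hj, Finset.mem_univ j⟩)
      linarith [hnn j]
  · push Not at h
    exact Or.inl (funext fun i => (h01 i).resolve_right (h i))

/-- On a selection vector (at most one entry, equal to `1`), the quadratic form of a matrix with
nonnegative diagonal is the square of the linear form given by the roots of the diagonal. -/
theorem quadForm_eq_sq_sqrt_diag {ι : Type*} [Fintype ι] [DecidableEq ι] {A : Matrix ι ι ℝ}
    (hA : ∀ i, 0 ≤ A i i) {x : ι → ℝ} (hx : x = 0 ∨ ∃ i, x = Pi.single i 1) :
    x ⬝ᵥ A *ᵥ x = ((fun i => Real.sqrt (A i i)) ⬝ᵥ x) ^ 2 := by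
  rcases hx with rfl | ⟨i, rfl⟩
  · simp
  · simp [Real.sq_sqrt (hA i)]

theorem quadForm_le_of_diag_le {ι : Type*} [Fintype ι] [DecidableEq ι] {A : Matrix ι ι ℝ}
    {c : ℝ} (hc : 0 ≤ c) (hA : ∀ i, A i i ≤ c) {x : ι → ℝ}
    (hx : x = 0 ∨ ∃ i, x = Pi.single i 1) : x ⬝ᵥ A *ᵥ x ≤ c := by
  rcases hx with rfl | ⟨i, rfl⟩
  · simpa using hc
  · simpa using hA i

theorem stmt_8 (n k : ℕ) (hn : 1 ≤ n) (hk : 1 ≤ k)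
    (K : Fin n → Matrix (Fin k) (Fin k) ℝ)
    (hK : ∀ t, (K t).PosSemidef)
    (Kbar : ℝ) (hKbar : 0 ≤ Kbar) (hKdiag : ∀ t l, K t l l ≤ Kbar)
    (γ : Fin n → Fin k → ℝ) (hγ : ∀ t l, γ t l = Real.sqrt (K t l l))
    (ψ : ℝ) (hψ : 0 ≤ ψ)
    (x : Fin n → Fin k → ℝ)
    (hx01 : ∀ t l, x t l = 0 ∨ x t l = 1)
    (hx1 : ∀ t, ∑ l, x t l ≤ 1) :
    0 ≤ ψ * Real.sqrt (∑ t, x t ⬝ᵥ (K t).mulVec (x t)) -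
        ψ / Real.sqrt n * ∑ t, γ t ⬝ᵥ x t ∧
      ψ * Real.sqrt (∑ t, x t ⬝ᵥ (K t).mulVec (x t)) -
          ψ / Real.sqrt n * ∑ t, γ t ⬝ᵥ x t ≤
        ψ * Real.sqrt Kbar * Real.sqrt n := by
  have hsel := fun t => eq_zero_or_eq_single_of_sum_le_one (hx01 t) (hx1 t)
  have hγ' : ∀ t, γ t = fun l => Real.sqrt (K t l l) := fun t => funext (hγ t)
  have hquad : ∀ t, x t ⬝ᵥ (K t).mulVec (x t) = (γ t ⬝ᵥ x t) ^ 2 := fun t => by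
    rw [hγ' t]
    exact quadForm_eq_sq_sqrt_diag (fun l => (hK t).diag_nonneg) (hsel t)
  have hlin : 0 ≤ ∑ t, γ t ⬝ᵥ x t := Finset.sum_nonneg fun t _ =>
    Finset.sum_nonneg fun l _ => mul_nonneg (by rw [hγ]; exact Real.sqrt_nonneg _)
      (by rcases hx01 t l with h | h <;> simp [h])
  have hn0 : (0 : ℝ) < Real.sqrt n := Real.sqrt_pos.mpr (by exact_mod_cast hn)
  have hcs : ∑ t, γ t ⬝ᵥ x t ≤
      Real.sqrt n * Real.sqrt (∑ t, x t ⬝ᵥ (K t).mulVec (x t)) := by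
    rw [← Real.sqrt_mul (Nat.cast_nonneg n), Finset.sum_congr rfl fun t _ => hquad t]
    apply Real.le_sqrt_of_sq_le
    simpa using sq_sum_le_card_mul_sum_sq (s := Finset.univ) (f := fun t => γ t ⬝ᵥ x t)
  have hub : Real.sqrt (∑ t, x t ⬝ᵥ (K t).mulVec (x t)) ≤ Real.sqrt Kbar * Real.sqrt n := by
    rw [← Real.sqrt_mul hKbar]
    apply Real.sqrt_le_sqrt
    have h := Finset.sum_le_card_nsmul Finset.univ (fun t => x t ⬝ᵥ (K t).mulVec (x t)) Kbar
      fun t _ => quadForm_le_of_diag_le hKbar (hKdiag t) (hsel t)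
    simpa [mul_comm] using h
  constructor
  · rw [sub_nonneg, div_mul_eq_mul_div, div_le_iff₀ hn0]
    calc ψ * ∑ t, γ t ⬝ᵥ x t
        ≤ ψ * (Real.sqrt n * Real.sqrt (∑ t, x t ⬝ᵥ (K t).mulVec (x t))) := by gcongr
      _ = _ := by ring
  · have h1 : 0 ≤ ψ / Real.sqrt n * ∑ t, γ t ⬝ᵥ x t := by positivity
    have h2 := mul_le_mul_of_nonneg_left hub hψ
    linarith
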